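/- There are infinitely many pairwise Witt-inequivalent fields of the form k(x) with k a quadratic extension of ℚ. Precisely: for every natural number n there exist pairwise distinct squarefree integers d_1, …, d_n, each different from 0 and 1, such that the rational function fields ℚ(√d_1)(x), …, ℚ(√d_n)(x) are pairwise not Witt equivalent. -/

import Mathlib

open MvPolynomial

noncomputable section

/-- The defining polynomial `a·x² + b·y² − 1` of the affine conic. -/
def conicPoly (k : Type*) [Field k] (a b : k) : MvPolynomial (Fin 2) k :=
  C a * X 0 ^ 2 + C b * X 1 ^ 2 - 1

/-- The coordinate ring `k[x,y]/(a·x² + b·y² − 1)` of the affine conic. -/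
abbrev ConicRing (k : Type*) [Field k] (a b : k) : Type _ :=
  MvPolynomial (Fin 2) k ⧸ Ideal.span {conicPoly k a b}

/-- `K` (together with the embedding `ι : k →+* K`) is a model of the function field
`k_{a,b}`, i.e. the quotient field of `k[x,y]/(a·x² + b·y² − 1)`. -/
def IsConicFunctionField (k : Type*) [Field k] (a b : k)
    (K : Type*) [Field K] (ι : k →+* K) : Prop :=
  ∃ f : ConicRing k a b →+* K,
    Function.Injective f ∧
    f.comp (algebraMap k (ConicRing k a b)) = ι ∧
    ∀ z : K, ∃ p q : ConicRing k a b, f q ≠ 0 ∧ z = f p / f q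

/-- The subgroup of squares in `Kˣ`. -/
def sqSubgroup (K : Type*) [Field K] : Subgroup Kˣ :=
  MonoidHom.range (powMonoidHom 2 : Kˣ →* Kˣ)

/-- The square class group `Kˣ/Kˣ²`. -/
abbrev SqClass (K : Type*) [Field K] := Kˣ ⧸ sqSubgroup K

/-- The square class of a unit. -/
def sqCl {K : Type*} [Field K] (u : Kˣ) : SqClass K := QuotientGroup.mk u

/-- `α : Kˣ/Kˣ² → Lˣ/Lˣ²` is a Witt equivalence: it sends `-1` to `-1` and preserves
binary value sets. -/
structure IsWittEquiv {K L : Type*} [Field K] [Field L]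
    (α : SqClass K ≃* SqClass L) : Prop where
  map_neg_one : α (sqCl (-1)) = sqCl (-1)
  represents : ∀ (a b c : Kˣ) (a' b' c' : Lˣ),
    α (sqCl a) = sqCl a' → α (sqCl b) = sqCl b' → α (sqCl c) = sqCl c' →
    ((∃ x y : K, (c : K) = (a : K) * x ^ 2 + (b : K) * y ^ 2) ↔
      (∃ x y : L, (c' : L) = (a' : L) * x ^ 2 + (b' : L) * y ^ 2))

/-- Two fields are Witt equivalent if there is a Witt equivalence between them. -/
def WittEquivalent (K L : Type*) [Field K] [Field L] : Prop :=
  ∃ α : SqClass K ≃* SqClass L, IsWittEquiv α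

/-- An ordering of a field `F`. -/
structure IsOrdering {F : Type*} [Field F] (P : Set F) : Prop where
  add_mem : ∀ x ∈ P, ∀ y ∈ P, x + y ∈ P
  mul_mem : ∀ x ∈ P, ∀ y ∈ P, x * y ∈ P
  total : ∀ x : F, x ∈ P ∨ -x ∈ P
  antisymm : ∀ x : F, x ∈ P → -x ∈ P → x = 0


/-- A pair of subgroups `T ≤ H` of `Kˣ` such that every element outside `H` is `T`-rigid, while
`H` contains an element which is not `T`-rigid. -/
structure IsRigidPair {K : Type*} [Field K] (T H : Subgroup Kˣ) : Prop where
  sq_mem : ∀ u : Kˣ, u ^ 2 ∈ T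
  le : T ≤ H
  neg_one_mem : -1 ∈ H
  rigid : ∀ b c : Kˣ, b ∉ H → (c : K) = 1 + b → c ∈ T ∨ b * c ∈ T
  nonrigid : ∃ h ∈ H, ∃ g : Kˣ, (g : K) = 1 + h ∧ -h ∉ T ∧ g ∉ T ∧ h * g ∉ T

/-- An element of `Kˣ` is ramified if it lies outside `H` for some rigid pair `(T, H)`. -/
def IsRamified {K : Type*} [Field K] (a : Kˣ) : Prop :=
  ∃ T H : Subgroup Kˣ, IsRigidPair T H ∧ a ∉ H

section Rigid

variable {K : Type*} [Field K]

/-- `x` and `y` lie in the same coset of the subgroup `T` of `Kˣ`. -/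
def SameCoset (T : Subgroup Kˣ) (x y : K) : Prop := ∃ t ∈ T, y = x * (t : K)

namespace SameCoset

variable {T H : Subgroup Kˣ} {x y z : K}

theorem refl (x : K) : SameCoset T x x := ⟨1, T.one_mem, by simp⟩

theorem symm (h : SameCoset T x y) : SameCoset T y x := by
  obtain ⟨t, ht, rfl⟩ := h
  exact ⟨t⁻¹, T.inv_mem ht, by simp⟩

theorem trans (h : SameCoset T x y) (h' : SameCoset T y z) : SameCoset T x z := by
  obtain ⟨t, ht, rfl⟩ := h
  obtain ⟨s, hs, rfl⟩ := h'
  exact ⟨t * s, T.mul_mem ht hs, by simp [mul_assoc]⟩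

theorem mono (hTH : T ≤ H) (h : SameCoset T x y) : SameCoset H x y := by
  obtain ⟨t, ht, e⟩ := h
  exact ⟨t, hTH ht, e⟩

theorem mul_left (z : K) (h : SameCoset T x y) : SameCoset T (z * x) (z * y) := by
  obtain ⟨t, ht, rfl⟩ := h
  exact ⟨t, ht, by ring⟩

theorem mul_left_iff (hz : z ≠ 0) : SameCoset T (z * x) (z * y) ↔ SameCoset T x y :=
  ⟨fun h => by simpa [hz] using h.mul_left z⁻¹, mul_left z⟩

theorem neg (h : SameCoset T x y) : SameCoset T (-x) (-y) := by
  simpa using h.mul_left (-1)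

theorem ne_zero (h : SameCoset T x y) (hx : x ≠ 0) : y ≠ 0 := by
  obtain ⟨t, -, rfl⟩ := h
  exact mul_ne_zero hx t.ne_zero

theorem units_iff {u v : Kˣ} : SameCoset T (u : K) v ↔ u⁻¹ * v ∈ T := by
  constructor
  · rintro ⟨t, ht, e⟩
    have : v = u * t := Units.ext (by simpa using e)
    simpa [this] using ht
  · intro h
    exact ⟨_, h, by simp⟩

end SameCoset

namespace IsRigidPair

variable {T H : Subgroup Kˣ}

theorem sameCoset_add_or (hp : IsRigidPair T H) {x y : K} (hx : x ≠ 0) (hy : y ≠ 0)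
    (hxy : ¬ SameCoset H x y) : SameCoset T x (x + y) ∨ SameCoset T y (x + y) := by
  lift x to Kˣ using hx.isUnit
  lift y to Kˣ using hy.isUnit
  rw [SameCoset.units_iff] at hxy
  have h0 : (1 : K) + ((x⁻¹ * y : Kˣ) : K) ≠ 0 := by
    intro h
    apply hxy
    convert hp.neg_one_mem
    ext
    simp only [Units.val_neg, Units.val_one]
    linear_combination h
  have hc : (x : K) + y = (x * Units.mk0 _ h0 : Kˣ) := by
    simp [mul_add]
  rw [hc, SameCoset.units_iff, SameCoset.units_iff]
  rcases hp.rigid _ (Units.mk0 _ h0) hxy rfl with h | h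
  · left; simpa using h
  · right
    have := T.mul_mem h (hp.sq_mem (x⁻¹ * y)⁻¹)
    convert this using 1
    ext
    simp only [Units.val_mul, Units.val_pow_eq_pow_val, Units.val_inv_eq_inv_val]
    field_simp

theorem not_sameCoset_add (hp : IsRigidPair T H) {x y : K}
    (hxy : ¬ SameCoset H x y) (h : SameCoset T x (x + y)) : ¬ SameCoset T y (x + y) :=
  fun h' => hxy ((h.trans h'.symm).mono hp.le)

theorem dominates_add (hp : IsRigidPair T H) {b x y : K} (hb : b ≠ 0) (hx : x ≠ 0) (hy : y ≠ 0)
    (hbx : ¬ SameCoset H b x) (hxy : SameCoset H x y) (hxy' : SameCoset H x (x + y))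
    (hne : ¬ SameCoset T y (x + y)) (h : SameCoset T b (b + x)) :
    SameCoset T b (b + (x + y)) := by
  have hby : ¬ SameCoset H b y := fun h' => hbx (h'.trans hxy.symm)
  have hbxy : ¬ SameCoset H b (x + y) := fun h' => hbx (h'.trans hxy'.symm)
  refine (hp.sameCoset_add_or hb (hxy'.ne_zero hx) hbxy).resolve_right fun h1 => ?_
  rcases hp.sameCoset_add_or (h.ne_zero hb) hy
    (fun h' => hby ((h.mono hp.le).trans h')) with h2 | h2
  · rw [add_assoc] at h2
    exact hbxy (((h.trans h2).trans h1.symm).mono hp.le)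
  · rw [add_assoc] at h2
    exact hne (h2.trans h1.symm)

/-- Up to domination the elements `1`, `-1` and a non-rigid `h` are interchangeable. -/
theorem exists_dominates_iff (hp : IsRigidPair T H) : ∃ h : Kˣ, h ∈ H ∧ -h ∉ T ∧
    ∀ b : K, b ≠ 0 → ¬ SameCoset H b 1 →
      ((SameCoset T b (b + 1) ↔ SameCoset T b (b + -1)) ∧
        (SameCoset T b (b + 1) ↔ SameCoset T b (b + h))) := by
  obtain ⟨h, hh, g, hg, h1, h2, h3⟩ := hp.nonrigid
  have hgH : g ∈ H := by
    by_contra hgH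
    have e1 : ¬ SameCoset H (g : K) (-1 : K) := by
      have : (-1 : K) = ((-1 : Kˣ) : K) := by simp
      rw [this, SameCoset.units_iff]
      intro h'
      exact hgH (by simpa using H.mul_mem h' hp.neg_one_mem)
    have e : (g : K) + -1 = h := by rw [hg]; ring
    rcases hp.sameCoset_add_or g.ne_zero (by simp) e1 with h' | h'
    · rw [e, SameCoset.units_iff] at h'
      exact hgH (by simpa using H.mul_mem hh (H.inv_mem (hp.le h')))
    · rw [e] at h'
      have := h'.neg
      rw [neg_neg, ← Units.val_one, ← Units.val_neg, SameCoset.units_iff] at this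
      exact h1 (by simpa using this)
  have hs : ∀ u : Kˣ, u ∈ T → u⁻¹ ∈ T := fun u => T.inv_mem
  have key : ∀ u v : Kˣ, u ∈ H → v ∈ H → SameCoset H (u : K) v := fun u v hu hv =>
    SameCoset.units_iff.2 (H.mul_mem (H.inv_mem hu) hv)
  refine ⟨h, hh, h1, fun b hb hb1 => ?_⟩
  have step : ∀ x y z : Kˣ, x ∈ H → y ∈ H → z ∈ H → (x : K) + y = z → y⁻¹ * z ∉ T →
      SameCoset T b (b + x) → SameCoset T b (b + z) := by
    intro x y z hx hy hz hxyz hyz hbx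
    have := hp.dominates_add hb x.ne_zero y.ne_zero
      (fun h' => hb1 (h'.trans (by simpa using key x 1 hx H.one_mem)))
      (key x y hx hy) (by rw [hxyz]; exact key x z hx hz)
      (by rwa [hxyz, SameCoset.units_iff]) hbx
    rwa [hxyz] at this
  have hn : ∀ u : Kˣ, u ∈ H → -u ∈ H := fun u hu => by
    simpa using H.mul_mem hp.neg_one_mem hu
  have m1 := H.one_mem
  have sq : ∀ u v : Kˣ, u * v ∉ T → u⁻¹ * v ∉ T := fun u v huv h' => huv (by
    have := T.mul_mem h' (hp.sq_mem u)
    convert this using 1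
    ext
    simp only [Units.val_mul, Units.val_pow_eq_pow_val, Units.val_inv_eq_inv_val]
    field_simp)
  have s1 := step 1 h g m1 hh hgH (by rw [hg]; simp) (sq _ _ h3)
  have s2 := step g (-1) h hgH (hn _ m1) hh (by rw [hg]; simp) (sq _ _ (by simpa using h1))
  have s3 := step g (-h) 1 hgH (hn _ hh) m1 (by rw [hg]; simp) (sq _ _ (by simpa using h1))
  have s4 := step 1 (-g) (-h) m1 (hn _ hgH) (hn _ hh) (by simp [hg])
    (sq _ _ (by simpa [mul_comm] using h3))
  have s5 := step (-h) (-1) (-g) (hn _ hh) (hn _ m1) (hn _ hgH) (by simp [hg])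
    (sq _ _ (by simpa using h2))
  have s6 := step (-g) h (-1) (hn _ hgH) hh (hn _ m1) (by simp [hg]) (sq _ _ (by simpa using h1))
  have s7 := step h 1 g hh m1 hgH (by simp [hg, add_comm]) (sq _ _ (by simpa using h2))
  have s8 := step (-1) g h (hn _ m1) hgH hh (by simp [hg]) (sq _ _ (by simpa [mul_comm] using h3))
  simp only [Units.val_one, Units.val_neg] at s1 s2 s3 s4 s5 s6 s7 s8
  exact ⟨⟨fun a => s6 (s5 (s4 a)), fun a => s3 (s7 (s8 a))⟩, ⟨fun a => s2 (s1 a),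
    fun a => s3 (s7 a)⟩⟩

theorem dominates_neg_iff (hp : IsRigidPair T H) {x y : K} (hx : x ≠ 0) (hy : y ≠ 0)
    (hxy : ¬ SameCoset H x y) : SameCoset T x (x + y) ↔ SameCoset T x (x + -y) := by
  obtain ⟨h, -, -, hh⟩ := hp.exists_dominates_iff
  have := (hh (y⁻¹ * x) (mul_ne_zero (inv_ne_zero hy) hx) (fun h' => hxy (by
    simpa [hy] using h'.mul_left y))).1
  rw [← SameCoset.mul_left_iff hy, ← SameCoset.mul_left_iff hy (y := _ + -1)] at this
  simpa [mul_add, hy] using this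

theorem one_dominates_add (hp : IsRigidPair T H) {b c : K} (hb : b ≠ 0)
    (hb1 : ¬ SameCoset H 1 b) (hc1 : SameCoset H 1 c)
    (h1 : SameCoset T 1 (1 + b)) (h2 : SameCoset T b (b + c)) :
    SameCoset T 1 (1 + (b + c)) := by
  have hbc : ¬ SameCoset H 1 (b + c) := fun h' => hb1 (h'.trans (h2.mono hp.le).symm)
  have hbc0 := h2.ne_zero hb
  refine (hp.sameCoset_add_or one_ne_zero hbc0 hbc).resolve_right fun h3 => ?_
  rw [add_comm 1] at h3
  obtain ⟨h, hhH, hhT, hh⟩ := hp.exists_dominates_iff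
  have i1 := hh b hb (fun h' => hb1 h'.symm)
  have i2 := hh (b + c) hbc0 (fun h' => hbc h'.symm)
  have h1' : ¬ SameCoset T b (b + 1) := by
    rw [add_comm]; exact hp.not_sameCoset_add hb1 h1
  have key : ∀ e : Kˣ, e ∈ H → SameCoset T (b + c) (b + c + e) → ¬ SameCoset T b (b + e) →
      SameCoset T (-e : K) c := by
    intro e he a1 a2
    have eH : SameCoset H 1 (e : K) := ⟨e, he, by simp⟩
    have eH' : SameCoset H 1 (-e : K) := ⟨-1 * e, H.mul_mem hp.neg_one_mem he, by simp⟩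
    have a3 : SameCoset T (e : K) (b + e) := (hp.sameCoset_add_or hb e.ne_zero
      (fun h' => hb1 (eH.trans h'.symm))).resolve_left a2
    have a4 : SameCoset T b (b + c + e) := h2.trans a1
    have a5 : SameCoset T (-e : K) (-(b + e)) := a3.neg
    have a6 : c = (b + c + e) + -(b + e) := by ring
    have a7 : ¬ SameCoset H (b + c + e) (-(b + e)) := fun h' =>
      hb1 (eH'.trans ((a5.mono hp.le).trans (h'.symm.trans (a4.mono hp.le).symm)))
    rcases hp.sameCoset_add_or (a4.ne_zero hb)
      (a5.ne_zero (neg_ne_zero.2 e.ne_zero)) a7 with a8 | a8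
    · rw [← a6] at a8
      exact absurd (hc1.trans ((a4.trans a8).mono hp.le).symm) hb1
    · rw [← a6] at a8
      exact a5.trans a8
  have k1 := key 1 H.one_mem (by simpa using h3) (by simpa using h1')
  have k2 := key (-1) hp.neg_one_mem (by simpa using i2.1.1 h3) (by simpa using i1.1.not.1 h1')
  have k3 := key h hhH (i2.2.1 h3) (i1.2.not.1 h1')
  simp only [Units.val_neg, Units.val_one, neg_neg] at k1 k2
  have k4 := k3.trans k2.symm
  rw [← Units.val_one, ← Units.val_neg, SameCoset.units_iff, mul_one] at k4
  exact hhT (by simpa using T.inv_mem k4)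

theorem dominates_add_of_dominates (hp : IsRigidPair T H) {a b c : K} (ha : a ≠ 0) (hb : b ≠ 0)
    (hab : ¬ SameCoset H a b) (hac : SameCoset H a c)
    (h1 : SameCoset T a (a + b)) (h2 : SameCoset T b (b + c)) :
    SameCoset T a (a + (b + c)) := by
  have ha' := inv_ne_zero ha
  rw [← SameCoset.mul_left_iff ha'] at hab hac h1 h2 ⊢
  simp only [mul_add, inv_mul_cancel₀ ha] at hab hac h1 h2 ⊢
  exact hp.one_dominates_add (mul_ne_zero ha' hb) hab hac h1 h2

/-- The elements of the coset `pH` which are dominated by `1`. -/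
def infinitesimals (T H : Subgroup Kˣ) (p : K) : Set K :=
  {y | SameCoset H p y ∧ SameCoset T 1 (1 + y)}

theorem one_add_mem_of_mem_closure (hp : IsRigidPair T H) {p : K} (hp0 : p ≠ 0)
    (hpH : ¬ SameCoset H 1 p) {w : K} (hw : w ∈ AddSubmonoid.closure (infinitesimals T H p)) :
    SameCoset T 1 (1 + w) ∧ ∀ y ∈ infinitesimals T H p, SameCoset T (1 + w) (1 + w + y) := by
  induction hw using AddSubmonoid.closure_induction_left with
  | zero => exact ⟨by simpa using SameCoset.refl _, fun y hy => by simpa using hy.2⟩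
  | add_left b hb w hw ih =>
    have e : (1 : K) + (b + w) = 1 + w + b := by ring
    rw [e]
    have hu := ih.2 b hb
    have h1u := ih.1.trans hu
    refine ⟨h1u, fun y hy => ?_⟩
    have hy0 := hy.1.ne_zero hp0
    have hyu : ¬ SameCoset H (1 + w + b) y := fun h' =>
      hpH (((h1u.mono hp.le).trans h').trans hy.1.symm)
    refine (hp.sameCoset_add_or (h1u.ne_zero one_ne_zero) hy0 hyu).resolve_right fun h => ?_
    have hyb : SameCoset H y (-b) :=
      (hy.1.symm.trans hb.1).trans ⟨-1, hp.neg_one_mem, by simp⟩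
    rw [add_comm] at h
    have h' := hp.dominates_add_of_dominates hy0 (h1u.ne_zero one_ne_zero)
      (fun h' => hyu h'.symm) hyb h (by simpa using hu.symm)
    have hyw : ¬ SameCoset H (1 + w) y := fun h' =>
      hpH (((ih.1.mono hp.le).trans h').trans hy.1.symm)
    refine hp.not_sameCoset_add hyw (ih.2 y hy) ?_
    convert h' using 1
    ring

theorem neg_mem_infinitesimals (hp : IsRigidPair T H) {p : K} (hp0 : p ≠ 0)
    (hpH : ¬ SameCoset H 1 p) {y : K} (hy : y ∈ infinitesimals T H p) :
    -y ∈ infinitesimals T H p :=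
  ⟨hy.1.trans ⟨-1, hp.neg_one_mem, by simp⟩,
    (hp.dominates_neg_iff one_ne_zero (hy.1.ne_zero hp0)
      (fun h' => hpH (h'.trans hy.1.symm))).1 hy.2⟩

theorem natCast_mem_infinitesimals (hp : IsRigidPair T H) {p : K} (hpH : ¬ SameCoset H 1 p)
    {n : ℕ} (hn : (n : K) ≠ 0) (hnp : SameCoset H p n) : (n : K) ∈ infinitesimals T H p := by
  have hp0 : p ≠ 0 := hnp.symm.ne_zero hn
  have hnH : ¬ SameCoset H 1 (n : K) := fun h' => hpH (h'.trans hnp.symm)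
  refine ⟨hnp, (hp.sameCoset_add_or one_ne_zero hn hnH).resolve_right fun h => ?_⟩
  have hinv : (n : K)⁻¹ ∈ infinitesimals T H p := by
    constructor
    · refine hnp.trans ⟨(Units.mk0 _ hn)⁻¹ ^ 2, hp.le (hp.sq_mem _), ?_⟩
      simp only [Units.val_pow_eq_pow_val, Units.val_inv_eq_inv_val, Units.val_mk0]
      field_simp
    · have := h.mul_left (n : K)⁻¹
      simpa [mul_add, hn, add_comm] using this
  have hmem : ((n * (n - 1) : ℕ) : K) * (n : K)⁻¹ ∈
      AddSubmonoid.closure (infinitesimals T H p) := by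
    rw [← nsmul_eq_mul]
    exact AddSubmonoid.nsmul_mem _ (AddSubmonoid.subset_closure hinv) _
  have h1 := (hp.one_add_mem_of_mem_closure hp0 hpH hmem).1
  have hn1 : 1 ≤ n := Nat.one_le_iff_ne_zero.2 (by rintro rfl; simp at hn)
  have e : (1 : K) + ((n * (n - 1) : ℕ) : K) * (n : K)⁻¹ = n := by
    push_cast [Nat.cast_sub hn1]
    field_simp
    ring
  rw [e] at h1
  exact hnH (h1.mono hp.le)

theorem mem_of_coprime_of_mul_eq_sq (hp : IsRigidPair T H) {p : Kˣ} {n m : ℕ} {e : K}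
    (hn : (p : K) = n) (hm : (m : K) ≠ 0) (hnm : n.Coprime m) (he : (n : K) * m = e ^ 2) :
    p ∈ H := by
  by_contra hpH
  have hpH' : ¬ SameCoset H 1 (p : K) := by
    rw [← Units.val_one, SameCoset.units_iff]; simpa using hpH
  have hn0 : (n : K) ≠ 0 := hn ▸ p.ne_zero
  have he0 : e ≠ 0 := by
    rintro rfl
    exact mul_ne_zero hn0 hm (by simpa using he)
  have hnJ := hp.natCast_mem_infinitesimals hpH' hn0 (hn ▸ SameCoset.refl _)
  have hmJ : (m : K) ∈ infinitesimals T H (p : K) := by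
    refine hp.natCast_mem_infinitesimals hpH' hm
      ⟨(Units.mk0 e he0) ^ 2 * p⁻¹ ^ 2, H.mul_mem (hp.le (hp.sq_mem _)) (hp.le (hp.sq_mem _)), ?_⟩
    simp only [Units.val_mul, Units.val_pow_eq_pow_val, Units.val_inv_eq_inv_val, Units.val_mk0,
      hn, ← he]
    field_simp
  have hmem : ∀ (j : ℕ) (s : ℤ), (j : K) ∈ infinitesimals T H (p : K) →
      ((s * j : ℤ) : K) ∈ AddSubmonoid.closure (infinitesimals T H (p : K)) := by
    intro j s hj
    obtain ⟨k, rfl | rfl⟩ := s.eq_nat_or_neg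
    · have := AddSubmonoid.nsmul_mem _ (AddSubmonoid.subset_closure hj) k
      simpa using this
    · have := AddSubmonoid.nsmul_mem _ (AddSubmonoid.subset_closure
        (hp.neg_mem_infinitesimals p.ne_zero hpH' hj)) k
      simpa using this
  have hb : (n : ℤ) * n.gcdA m + m * n.gcdB m = 1 := by
    rw [← Nat.gcd_eq_gcd_ab, hnm.gcd_eq_one]; rfl
  have hsum := AddSubmonoid.add_mem _ (hmem n (-n.gcdA m) hnJ) (hmem m (-n.gcdB m) hmJ)
  have e1 : ((-n.gcdA m * n : ℤ) : K) + ((-n.gcdB m * m : ℤ) : K) = -1 := by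
    rw [← Int.cast_add]
    have : -n.gcdA m * n + -n.gcdB m * m = (-1 : ℤ) := by linear_combination -hb
    rw [this]; simp
  rw [e1] at hsum
  exact (hp.one_add_mem_of_mem_closure p.ne_zero hpH' hsum).1.ne_zero one_ne_zero (by simp)

end IsRigidPair

end Rigid

section PrimeElement

theorem dvd_mul_sub_mul_of_dvd_sub {R : Type*} [CommRing R] {π r s r' s' : R}
    (h : π ∣ r - s) (h' : π ∣ r' - s') :
    π ∣ r * r' - s * s' := by
  have e : r * r' - s * s' = (r - s) * r' + s * (r' - s') := by ring
  rw [e]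
  exact dvd_add (h.mul_right _) (h'.mul_left _)

variable {R K : Type*} [CommRing R] [IsDomain R] [Field K] [Algebra R K] [IsFractionRing R K]

theorem exists_units_mul_eq_zpow_mul [WfDvdMonoid R] {π : R} (hπ : Prime π) (z : Kˣ) :
    ∃ (n : ℤ) (r s : R), ¬ π ∣ r ∧ ¬ π ∣ s ∧
      (z : K) * algebraMap R K s = algebraMap R K π ^ n * algebraMap R K r := by
  obtain ⟨a, b, hb, hz⟩ := IsFractionRing.div_surjective (A := R) (z : K)
  have hb0 : b ≠ 0 := nonZeroDivisors.ne_zero hb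
  have ha0 : a ≠ 0 := by
    rintro rfl
    exact z.ne_zero (by simpa using hz.symm)
  obtain ⟨n, r, hr, rfl⟩ := WfDvdMonoid.max_power_factor ha0 hπ.irreducible
  obtain ⟨m, s, hs, rfl⟩ := WfDvdMonoid.max_power_factor hb0 hπ.irreducible
  refine ⟨n - m, r, s, hr, hs, ?_⟩
  have hπ0 : algebraMap R K π ≠ 0 := by simpa using hπ.ne_zero
  have hs0 : algebraMap R K s ≠ 0 := by
    simpa using fun h : s = 0 => hs (h ▸ dvd_zero π)
  rw [← hz, zpow_sub₀ hπ0]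
  simp only [map_mul, map_pow, zpow_natCast]
  field_simp

variable (K) in
/-- The units of `K` which have even valuation at the prime element `π` of `R`. -/
def evenSubgroup {π : R} (hπ : Prime π) : Subgroup Kˣ where
  carrier := {u | ∃ (c : Kˣ) (r s : R), ¬ π ∣ r ∧ ¬ π ∣ s ∧
    (u : K) * algebraMap R K s = (c : K) ^ 2 * algebraMap R K r}
  one_mem' := ⟨1, 1, 1, hπ.not_dvd_one, hπ.not_dvd_one, by simp⟩
  mul_mem' := by
    rintro u v ⟨c, r, s, hr, hs, e⟩ ⟨c', r', s', hr', hs', e'⟩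
    refine ⟨c * c', r * r', s * s', hπ.not_dvd_mul hr hr', hπ.not_dvd_mul hs hs', ?_⟩
    simp only [Units.val_mul, map_mul]
    linear_combination v * algebraMap R K s' * e + c ^ 2 * algebraMap R K r * e'
  inv_mem' := by
    rintro u ⟨c, r, s, hr, hs, e⟩
    refine ⟨c⁻¹, s, r, hs, hr, ?_⟩
    simp only [Units.val_inv_eq_inv_val]
    field_simp
    linear_combination -e

variable (K) in
/-- The units of `K` which are a square times a unit congruent to `1` modulo the prime
element `π` of `R`. -/
def oneUnitSubgroup {π : R} (hπ : Prime π) : Subgroup Kˣ where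
  carrier := {u | ∃ (c : Kˣ) (r s : R), ¬ π ∣ r ∧ ¬ π ∣ s ∧ π ∣ r - s ∧
    (u : K) * algebraMap R K s = (c : K) ^ 2 * algebraMap R K r}
  one_mem' := ⟨1, 1, 1, hπ.not_dvd_one, hπ.not_dvd_one, by simp, by simp⟩
  mul_mem' := by
    rintro u v ⟨c, r, s, hr, hs, h, e⟩ ⟨c', r', s', hr', hs', h', e'⟩
    refine ⟨c * c', r * r', s * s', hπ.not_dvd_mul hr hr', hπ.not_dvd_mul hs hs',
      dvd_mul_sub_mul_of_dvd_sub h h', ?_⟩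
    simp only [Units.val_mul, map_mul]
    linear_combination v * algebraMap R K s' * e + c ^ 2 * algebraMap R K r * e'
  inv_mem' := by
    rintro u ⟨c, r, s, hr, hs, h, e⟩
    refine ⟨c⁻¹, s, r, hs, hr, (dvd_sub_comm).1 h, ?_⟩
    simp only [Units.val_inv_eq_inv_val]
    field_simp
    linear_combination -e

variable [WfDvdMonoid R] {π : R}

theorem exists_dvd_of_mem_oneUnitSubgroup (hπ : Prime π) {q : R} (hq : ¬ π ∣ q) {u : Kˣ}
    (hu : (u : K) = algebraMap R K q) (h : u ∈ oneUnitSubgroup K hπ) :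
    ∃ r s : R, ¬ π ∣ r ∧ π ∣ q * r ^ 2 - s ^ 2 := by
  obtain ⟨c, r, s, hr, hs, hrs, e⟩ := h
  obtain ⟨n, x, y, hx, hy, e'⟩ := exists_units_mul_eq_zpow_mul (R := R) hπ c
  have hπ0 : algebraMap R K π ≠ 0 := by simpa using hπ.ne_zero
  have inj := IsFractionRing.injective R K
  have sq : ∀ {a : R}, ¬ π ∣ a → ¬ π ∣ a ^ 2 := fun ha h => ha (hπ.dvd_of_dvd_pow h)
  have E : algebraMap R K (q * s * y ^ 2) =
      (algebraMap R K π ^ n) ^ 2 * algebraMap R K (r * x ^ 2) := by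
    simp only [map_mul, map_pow, ← hu]
    linear_combination algebraMap R K y ^ 2 * e + algebraMap R K r *
      (c * algebraMap R K y + algebraMap R K π ^ n * algebraMap R K x) * e'
  obtain ⟨k, rfl | rfl⟩ := n.eq_nat_or_neg
  · rw [zpow_natCast, ← map_pow, ← map_pow, ← map_mul] at E
    have E := inj E
    rcases k.eq_zero_or_pos with rfl | hk
    · refine ⟨y, x, hy, (hπ.dvd_or_dvd ?_).resolve_left hs⟩
      have : s * (q * y ^ 2 - x ^ 2) = (r - s) * x ^ 2 := by
        simp only [pow_zero, one_pow, one_mul] at E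
        linear_combination E
      rw [this]
      exact hrs.mul_right _
    · refine absurd ?_ (hπ.not_dvd_mul (hπ.not_dvd_mul hq hs) (sq hy))
      rw [E]
      exact ((dvd_pow_self π hk.ne').trans (dvd_pow_self _ two_ne_zero)).mul_right _
  · have E : algebraMap R K ((π ^ k) ^ 2 * (q * s * y ^ 2)) = algebraMap R K (r * x ^ 2) := by
      rw [map_mul, E, map_pow, map_pow, zpow_neg, zpow_natCast]
      field_simp
    have E := inj E
    rcases k.eq_zero_or_pos with rfl | hk
    · refine ⟨y, x, hy, (hπ.dvd_or_dvd ?_).resolve_left hs⟩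
      have : s * (q * y ^ 2 - x ^ 2) = (r - s) * x ^ 2 := by
        simp only [pow_zero, one_pow, one_mul] at E
        linear_combination E
      rw [this]
      exact hrs.mul_right _
    · refine absurd ?_ (hπ.not_dvd_mul hr (sq hx))
      rw [← E]
      exact ((dvd_pow_self π hk.ne').trans (dvd_pow_self _ two_ne_zero)).mul_right _

theorem notMem_evenSubgroup (hπ : Prime π) {a : R} (ha : ¬ π ∣ a) {u : Kˣ}
    (hu : (u : K) = algebraMap R K (π * a)) : u ∉ evenSubgroup K hπ := by
  rintro ⟨c, r, s, hr, hs, e⟩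
  obtain ⟨n, x, y, hx, hy, e'⟩ := exists_units_mul_eq_zpow_mul (R := R) hπ c
  have hπ0 : algebraMap R K π ≠ 0 := by simpa using hπ.ne_zero
  have inj := IsFractionRing.injective R K
  have sq : ∀ {a : R}, ¬ π ∣ a → ¬ π ∣ a ^ 2 := fun ha h => ha (hπ.dvd_of_dvd_pow h)
  have E : algebraMap R K (π * (a * s * y ^ 2)) =
      (algebraMap R K π ^ n) ^ 2 * algebraMap R K (r * x ^ 2) := by
    have : algebraMap R K (π * (a * s * y ^ 2)) =
      algebraMap R K (π * a) * algebraMap R K s * algebraMap R K y ^ 2 := by simp; ring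
    rw [this, ← hu]
    simp only [map_mul, map_pow]
    linear_combination algebraMap R K y ^ 2 * e + algebraMap R K r *
      (c * algebraMap R K y + algebraMap R K π ^ n * algebraMap R K x) * e'
  have hneg : ∀ k : ℕ, π * ((π ^ k) ^ 2 * (a * s * y ^ 2)) ≠ r * x ^ 2 := fun k h =>
    hπ.not_dvd_mul hr (sq hx) (h ▸ dvd_mul_right _ _)
  obtain ⟨k, rfl | rfl⟩ := n.eq_nat_or_neg
  · rw [zpow_natCast, ← map_pow, ← map_pow, ← map_mul] at E
    have E := inj E
    rcases k with _ | k
    · exact hneg 0 (by simpa using E)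
    · have E : a * s * y ^ 2 = π * ((π ^ k) ^ 2 * (r * x ^ 2)) :=
        mul_left_cancel₀ hπ.ne_zero (by rw [E]; ring)
      exact hπ.not_dvd_mul (hπ.not_dvd_mul ha hs) (sq hy) (E ▸ dvd_mul_right _ _)
  · refine hneg k (inj ?_)
    rw [mul_left_comm, map_mul, E, map_pow, map_pow, zpow_neg, zpow_natCast]
    field_simp

theorem isRigidPair_of_prime (hπ : Prime π) {h : R}
    (h1 : ∀ r s : R, ¬ π ∣ r → ¬ π ∣ -h * r ^ 2 - s ^ 2)
    (h2 : ∀ r s : R, ¬ π ∣ r → ¬ π ∣ (1 + h) * r ^ 2 - s ^ 2)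
    (h3 : ∀ r s : R, ¬ π ∣ r → ¬ π ∣ h * (1 + h) * r ^ 2 - s ^ 2) :
    IsRigidPair (oneUnitSubgroup K hπ) (evenSubgroup K hπ) where
  sq_mem u := ⟨u, 1, 1, hπ.not_dvd_one, hπ.not_dvd_one, by simp, by simp⟩
  le := by
    rintro u ⟨c, r, s, hr, hs, -, e⟩
    exact ⟨c, r, s, hr, hs, e⟩
  neg_one_mem := ⟨1, -1, 1, by simpa using hπ.not_dvd_one, hπ.not_dvd_one, by simp⟩
  rigid b c hb hc := by
    obtain ⟨n, r, s, hr, hs, e⟩ := exists_units_mul_eq_zpow_mul (R := R) hπ b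
    have hπ0 : algebraMap R K π ≠ 0 := by simpa using hπ.ne_zero
    have key : ∀ {x : R} (y : R) {k : ℕ}, 0 < k → ¬ π ∣ x → ¬ π ∣ x + π ^ k * y := by
      intro x y k hk hx h
      exact hx ((dvd_add_left ((dvd_pow_self π hk.ne').mul_right y)).1 h)
    obtain ⟨k, rfl | rfl⟩ := n.eq_nat_or_neg
    · rcases k.eq_zero_or_pos with rfl | hk
      · exact absurd ⟨1, r, s, hr, hs, by simpa using e⟩ hb
      refine Or.inl ⟨1, s + π ^ k * r, s, key r hk hs, hs, ?_, ?_⟩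
      · rw [add_sub_cancel_left]
        exact (dvd_pow_self π hk.ne').mul_right r
      · rw [zpow_natCast] at e
        simp only [hc, map_add, map_mul, map_pow, Units.val_one]
        linear_combination e
    · rcases k.eq_zero_or_pos with rfl | hk
      · exact absurd ⟨1, r, s, hr, hs, by simpa using e⟩ hb
      refine Or.inr ⟨b, r + π ^ k * s, r, key s hk hr, hr, ?_, ?_⟩
      · rw [add_sub_cancel_left]
        exact (dvd_pow_self π hk.ne').mul_right s
      · rw [zpow_neg, zpow_natCast] at e
        field_simp at e
        simp only [Units.val_mul, hc, map_add, map_mul, map_pow]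
        linear_combination - b * e
  nonrigid := by
    have n1 : ¬ π ∣ h := by simpa using h1 1 0 hπ.not_dvd_one
    have n2 : ¬ π ∣ 1 + h := by simpa using h2 1 0 hπ.not_dvd_one
    have inj := IsFractionRing.injective R K
    have z1 : algebraMap R K h ≠ 0 := by
      simpa using fun e : h = 0 => n1 (e ▸ dvd_zero π)
    have z2 : algebraMap R K (1 + h) ≠ 0 := fun e =>
      n2 ((map_eq_zero_iff _ inj).1 e ▸ dvd_zero π)
    refine ⟨Units.mk0 _ z1, ⟨1, h, 1, n1, hπ.not_dvd_one, by simp⟩, Units.mk0 _ z2, by simp,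
      fun hm => ?_, fun hm => ?_, fun hm => ?_⟩
    · obtain ⟨r, s, hr, hd⟩ := exists_dvd_of_mem_oneUnitSubgroup hπ (q := -h) (by simpa using n1)
        (by simp) hm
      exact h1 r s hr hd
    · obtain ⟨r, s, hr, hd⟩ := exists_dvd_of_mem_oneUnitSubgroup hπ n2 (by simp) hm
      exact h2 r s hr hd
    · obtain ⟨r, s, hr, hd⟩ := exists_dvd_of_mem_oneUnitSubgroup hπ (q := h * (1 + h))
        (hπ.not_dvd_mul n1 n2) (by simp) hm
      exact h3 r s hr hd

/-- An element of odd valuation at a prime element `π` is ramified, as soon as the residue ring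
`R ⧸ (π)` contains a non-rigid element. -/
theorem isRamified_of_prime (hπ : Prime π) {h a : R} {u : Kˣ}
    (h1 : ∀ r s : R, ¬ π ∣ r → ¬ π ∣ -h * r ^ 2 - s ^ 2)
    (h2 : ∀ r s : R, ¬ π ∣ r → ¬ π ∣ (1 + h) * r ^ 2 - s ^ 2)
    (h3 : ∀ r s : R, ¬ π ∣ r → ¬ π ∣ h * (1 + h) * r ^ 2 - s ^ 2)
    (ha : ¬ π ∣ a) (hu : (u : K) = algebraMap R K (π * a)) : IsRamified u :=
  ⟨_, _, isRigidPair_of_prime hπ h1 h2 h3, notMem_evenSubgroup hπ ha hu⟩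

end PrimeElement

section Transport

variable {K L : Type*} [Field K] [Field L]

theorem sqCl_surjective (s : SqClass K) : ∃ u : Kˣ, sqCl u = s := QuotientGroup.mk_surjective s

theorem sqCl_eq_iff {u v : Kˣ} : sqCl u = sqCl v ↔ ∃ w : Kˣ, v = u * w ^ 2 := by
  rw [sqCl, sqCl, QuotientGroup.eq]
  constructor
  · rintro ⟨w, hw⟩
    exact ⟨w, by rw [show w ^ 2 = u⁻¹ * v from hw, mul_inv_cancel_left]⟩
  · rintro ⟨w, rfl⟩
    exact ⟨w, by simp⟩

theorem sqCl_mul (u v : Kˣ) : sqCl (u * v) = sqCl u * sqCl v := rfl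

theorem IsRigidPair.mem_or_of_represents {T H : Subgroup Kˣ} (hp : IsRigidPair T H) {b c : Kˣ}
    (hb : b ∉ H) (hc : ∃ x y : K, (c : K) = ((1 : Kˣ) : K) * x ^ 2 + (b : K) * y ^ 2) :
    c ∈ T ∨ b * c ∈ T := by
  obtain ⟨x, y, e⟩ := hc
  rw [Units.val_one, one_mul] at e
  rcases eq_or_ne x 0 with rfl | hx
  · have hy : y ≠ 0 := by
      rintro rfl
      simp at e
    right
    convert hp.sq_mem (b * Units.mk0 y hy) using 1
    ext
    simp [e]
    ring
  rcases eq_or_ne y 0 with rfl | hy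
  · left
    convert hp.sq_mem (Units.mk0 x hx) using 1
    ext
    simp [e]
  set X := Units.mk0 x hx
  set Y := Units.mk0 y hy
  have hb' : b * (Y * X⁻¹) ^ 2 ∉ H := fun h =>
    hb ((H.mul_mem_cancel_right (hp.le (hp.sq_mem _))).1 h)
  have e' : ((c * X⁻¹ ^ 2 : Kˣ) : K) = 1 + ((b * (Y * X⁻¹) ^ 2 : Kˣ) : K) := by
    simp [X, Y, e]
    field_simp
  rcases hp.rigid _ _ hb' e' with h | h
  · exact Or.inl ((T.mul_mem_cancel_right (hp.sq_mem _)).1 h)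
  · right
    have e2 : b * (Y * X⁻¹) ^ 2 * (c * X⁻¹ ^ 2) = b * c * (Y * X⁻¹ * X⁻¹) ^ 2 := by
      simp only [mul_pow]
      ac_rfl
    rw [e2] at h
    exact (T.mul_mem_cancel_right (hp.sq_mem _)).1 h

theorem IsRigidPair.exists_nonrigid_of_represents {T H : Subgroup Kˣ}
    (sq_mem : ∀ u : Kˣ, u ^ 2 ∈ T) (le : T ≤ H) {h g : Kˣ} (hh : h ∈ H) (h1 : -h ∉ T)
    (h2 : g ∉ T) (h3 : h * g ∉ T)
    (hg : ∃ x y : K, (g : K) = ((1 : Kˣ) : K) * x ^ 2 + (h : K) * y ^ 2) :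
    ∃ h ∈ H, ∃ g : Kˣ, (g : K) = 1 + h ∧ -h ∉ T ∧ g ∉ T ∧ h * g ∉ T := by
  obtain ⟨x, y, e⟩ := hg
  rw [Units.val_one, one_mul] at e
  have hx : x ≠ 0 := by
    rintro rfl
    have hy : y ≠ 0 := by
      rintro rfl
      simp at e
    apply h3
    convert sq_mem (h * Units.mk0 y hy) using 1
    ext
    simp [e]
    ring
  have hy : y ≠ 0 := by
    rintro rfl
    apply h2
    convert sq_mem (Units.mk0 x hx) using 1
    ext
    simp [e]
  set X := Units.mk0 x hx
  set Y := Units.mk0 y hy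
  refine ⟨h * (Y * X⁻¹) ^ 2, H.mul_mem hh (le (sq_mem _)), g * X⁻¹ ^ 2, ?_, ?_, ?_, ?_⟩
  · simp [X, Y, e]
    field_simp
  · rw [← neg_mul, T.mul_mem_cancel_right (sq_mem _)]
    exact h1
  · rwa [T.mul_mem_cancel_right (sq_mem _)]
  · have e2 : h * (Y * X⁻¹) ^ 2 * (g * X⁻¹ ^ 2) = h * g * (Y * X⁻¹ * X⁻¹) ^ 2 := by
      simp only [mul_pow]
      ac_rfl
    rwa [e2, T.mul_mem_cancel_right (sq_mem _)]

/-- The subgroup of `Lˣ` corresponding to a subgroup of `Kˣ` under an isomorphism of square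
class groups. -/
def transferSubgroup (α : SqClass K ≃* SqClass L) (T : Subgroup Kˣ) : Subgroup Lˣ :=
  ((T.map (QuotientGroup.mk' (sqSubgroup K))).map α.toMonoidHom).comap
    (QuotientGroup.mk' (sqSubgroup L))

theorem mem_transferSubgroup {α : SqClass K ≃* SqClass L} {T : Subgroup Kˣ}
    (hT : ∀ u : Kˣ, u ^ 2 ∈ T) {u : Kˣ} {u' : Lˣ} (h : α (sqCl u) = sqCl u') :
    u' ∈ transferSubgroup α T ↔ u ∈ T := by
  constructor
  · rintro ⟨_, ⟨v, hv, rfl⟩, hα⟩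
    have : sqCl v = sqCl u := α.injective (hα.trans h.symm)
    obtain ⟨w, rfl⟩ := sqCl_eq_iff.1 this
    exact T.mul_mem hv (hT w)
  · intro hu
    exact ⟨_, ⟨u, hu, rfl⟩, h⟩

theorem IsWittEquiv.symm {α : SqClass K ≃* SqClass L} (hα : IsWittEquiv α) :
    IsWittEquiv α.symm where
  map_neg_one := by rw [MulEquiv.symm_apply_eq, hα.map_neg_one]
  represents a b c a' b' c' ha hb hc := by
    rw [MulEquiv.symm_apply_eq] at ha hb hc
    exact (hα.represents a' b' c' a b c ha.symm hb.symm hc.symm).symm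

theorem IsWittEquiv.isRigidPair {α : SqClass K ≃* SqClass L} (hα : IsWittEquiv α)
    {T H : Subgroup Kˣ} (hp : IsRigidPair T H) :
    IsRigidPair (transferSubgroup α T) (transferSubgroup α H) := by
  have sqH : ∀ u : Kˣ, u ^ 2 ∈ H := fun u => hp.le (hp.sq_mem u)
  have lift : ∀ u' : Lˣ, ∃ u : Kˣ, α (sqCl u) = sqCl u' := fun u' => by
    obtain ⟨u, hu⟩ := sqCl_surjective (α.symm (sqCl u'))
    exact ⟨u, by rw [hu, α.apply_symm_apply]⟩
  have h1 : α (sqCl 1) = sqCl 1 := map_one α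
  have hmul : ∀ {u v : Kˣ} {u' v' : Lˣ}, α (sqCl u) = sqCl u' → α (sqCl v) = sqCl v' →
      α (sqCl (u * v)) = sqCl (u' * v') := fun hu hv => by
    rw [sqCl_mul, map_mul, hu, hv, sqCl_mul]
  have sqT : ∀ u : Lˣ, u ^ 2 ∈ transferSubgroup α T := fun u => by
    rw [mem_transferSubgroup hp.sq_mem (u := 1)]
    · exact T.one_mem
    · rw [h1, sqCl_eq_iff]
      exact ⟨u, by simp⟩
  have le : transferSubgroup α T ≤ transferSubgroup α H := fun u' hu' => by
    obtain ⟨u, hu⟩ := lift u'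
    rw [mem_transferSubgroup hp.sq_mem hu] at hu'
    exact (mem_transferSubgroup sqH hu).2 (hp.le hu')
  refine ⟨sqT, le, (mem_transferSubgroup sqH hα.map_neg_one).2 hp.neg_one_mem, ?_, ?_⟩
  · intro b' c' hb' hc'
    obtain ⟨b, hb⟩ := lift b'
    obtain ⟨c, hc⟩ := lift c'
    rw [mem_transferSubgroup sqH hb] at hb'
    rw [mem_transferSubgroup hp.sq_mem hc, mem_transferSubgroup hp.sq_mem (hmul hb hc)]
    exact hp.mem_or_of_represents hb'
      ((hα.represents 1 b c 1 b' c' h1 hb hc).2 ⟨1, 1, by simp [hc']⟩)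
  · obtain ⟨h, hh, g, hg, n1, n2, n3⟩ := hp.nonrigid
    obtain ⟨h', hh'⟩ := sqCl_surjective (α (sqCl h))
    obtain ⟨g', hg'⟩ := sqCl_surjective (α (sqCl g))
    have hneg := hmul hα.map_neg_one hh'.symm
    rw [neg_one_mul, neg_one_mul] at hneg
    refine IsRigidPair.exists_nonrigid_of_represents sqT le
      ((mem_transferSubgroup sqH hh'.symm).2 hh)
      (mt (mem_transferSubgroup hp.sq_mem hneg).1 n1)
      (mt (mem_transferSubgroup hp.sq_mem hg'.symm).1 n2)
      (mt (mem_transferSubgroup hp.sq_mem (hmul hh'.symm hg'.symm)).1 n3)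
      ((hα.represents 1 h g 1 h' g' h1 hh'.symm hg'.symm).1 ⟨1, 1, by simp [hg]⟩)

theorem IsWittEquiv.isRamified {α : SqClass K ≃* SqClass L} (hα : IsWittEquiv α) {a : Kˣ}
    {a' : Lˣ} (h : α (sqCl a) = sqCl a') (ha : IsRamified a) : IsRamified a' := by
  obtain ⟨T, H, hp, haH⟩ := ha
  exact ⟨_, _, hα.isRigidPair hp,
    mt (mem_transferSubgroup (fun u => hp.le (hp.sq_mem u)) h).1 haH⟩

theorem IsRamified.of_sqCl_eq {a b : Kˣ} (h : sqCl a = sqCl b) (ha : IsRamified a) :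
    IsRamified b := by
  obtain ⟨T, H, hp, haH⟩ := ha
  obtain ⟨w, rfl⟩ := sqCl_eq_iff.1 h
  exact ⟨T, H, hp, fun hb => haH ((H.mul_mem_cancel_right (hp.le (hp.sq_mem w))).1 hb)⟩

variable (K) in
/-- The set of square classes of `K` which are not ramified. -/
def unramifiedClasses : Set (SqClass K) := {s | ∀ a : Kˣ, sqCl a = s → ¬ IsRamified a}

theorem WittEquivalent.ncard_unramifiedClasses_eq (h : WittEquivalent K L) :
    (unramifiedClasses K).ncard = (unramifiedClasses L).ncard := by
  obtain ⟨α, hα⟩ := h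
  rw [← Set.ncard_image_of_injective _ α.injective]
  congr 1
  ext s
  constructor
  · rintro ⟨t, ht, rfl⟩ a' ha' hr
    obtain ⟨a, rfl⟩ := sqCl_surjective t
    exact ht a rfl (hα.symm.isRamified (by rw [ha', α.symm_apply_apply]) hr)
  · intro hs
    refine ⟨α.symm s, fun a ha hr => ?_, α.apply_symm_apply s⟩
    obtain ⟨a', rfl⟩ := sqCl_surjective s
    exact hs a' rfl (hα.isRamified (by rw [ha, α.apply_symm_apply]) hr)

end Transport

section NumberField

open NumberField IsDedekindDomain

theorem not_isSquare_of_valuation_eq_exp_neg_one {F : Type*} [Field F]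
    {v : Valuation F (WithZero (Multiplicative ℤ))} {x : F} (h : v x = WithZero.exp (-1)) :
    ¬ IsSquare x := by
  rintro ⟨y, rfl⟩
  have hy : v y ≠ 0 := by
    intro h0
    rw [map_mul, h0, zero_mul] at h
    exact WithZero.exp_ne_zero h.symm
  have := congrArg WithZero.log h
  rw [map_mul, WithZero.log_mul hy hy, WithZero.log_exp] at this
  omega

theorem exists_heightOneSpectrum_natCast_mem (k : Type*) [Field k] [NumberField k] {p : ℕ}
    (hp : p.Prime) : ∃ v : HeightOneSpectrum (𝓞 k), (p : 𝓞 k) ∈ v.asIdeal := by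
  have hne : Ideal.span {(p : 𝓞 k)} ≠ ⊤ := by
    rw [Ne, Ideal.span_singleton_eq_top]
    intro hu
    obtain ⟨u, hu⟩ := hu.dvd (a := 1)
    have e : algebraMap ℚ k (p : ℚ)⁻¹ = (u : k) := by
      have := congrArg (algebraMap (𝓞 k) k) hu
      simp only [map_one, map_mul, map_natCast] at this
      rw [map_inv₀, map_natCast]
      exact (eq_inv_of_mul_eq_one_right this.symm).symm
    have hi : IsIntegral ℤ (algebraMap ℚ k (p : ℚ)⁻¹) := e ▸ RingOfIntegers.isIntegral_coe u
    rw [isIntegral_algebraMap_iff (algebraMap ℚ k).injective] at hi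
    obtain ⟨n, hn⟩ := IsIntegrallyClosed.isIntegral_iff.1 hi
    have hp0 : (p : ℚ) ≠ 0 := by exact_mod_cast hp.ne_zero
    have : (n * p : ℤ) = 1 := by
      have : (n : ℚ) * p = 1 := by
        rw [show (n : ℚ) = (p : ℚ)⁻¹ from hn]; field_simp
      exact_mod_cast this
    have h2 := Int.isUnit_iff.1 (IsUnit.of_mul_eq_one n (by rwa [mul_comm] at this))
    have := hp.two_le
    omega
  obtain ⟨M, hM, hle⟩ := Ideal.exists_le_maximal _ hne
  have hmem : (p : 𝓞 k) ∈ M := hle (Ideal.mem_span_singleton_self _)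
  refine ⟨⟨M, hM.isPrime, ?_⟩, hmem⟩
  rintro rfl
  rw [Ideal.mem_bot] at hmem
  exact hp.ne_zero (by exact_mod_cast hmem)

theorem exists_not_isSquare (k : Type*) [Field k] [NumberField k] :
    ∃ ϖ : k, ¬ IsSquare ϖ ∧ ¬ IsSquare (1 - ϖ) ∧ ¬ IsSquare ((ϖ - 1) * ϖ) := by
  obtain ⟨v, hv⟩ := exists_heightOneSpectrum_natCast_mem k Nat.prime_two
  obtain ⟨w, hw⟩ := exists_heightOneSpectrum_natCast_mem k Nat.prime_three
  have hvw : IsCoprime (v.asIdeal ^ 2) (w.asIdeal ^ 2) := by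
    apply IsCoprime.pow
    rw [Ideal.isCoprime_iff_exists]
    refine ⟨-2, neg_mem (by simpa using hv), 3, by simpa using hw, by norm_num⟩
  obtain ⟨a, ha⟩ := v.intValuation_exists_uniformizer
  obtain ⟨b, hb⟩ := w.intValuation_exists_uniformizer
  obtain ⟨x, hx, y, hy, hxy⟩ := Ideal.isCoprime_iff_exists.1 hvw
  have key : ∀ (v : HeightOneSpectrum (𝓞 k)) (a x : 𝓞 k),
      v.intValuation a = WithZero.exp (-1) → x ∈ v.asIdeal ^ 2 →
      v.valuation k (algebraMap (𝓞 k) k (a + x)) = WithZero.exp (-1) := by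
    intro v a x ha hx
    rw [HeightOneSpectrum.valuation_of_algebraMap, ← ha]
    apply Valuation.map_add_eq_of_lt_left
    rw [ha]
    exact ((v.intValuation_le_pow_iff_mem x 2).2 hx).trans_lt
      (by rw [WithZero.exp_lt_exp]; norm_num)
  have h1 := key v a ((1 - b - a) * x) ha (Ideal.mul_mem_left _ _ hx)
  have h2 := key w b ((1 - b - a) * y) hb (Ideal.mul_mem_left _ _ hy)
  have e : algebraMap (𝓞 k) k (b + (1 - b - a) * y) =
      1 - algebraMap (𝓞 k) k (a + (1 - b - a) * x) := by
    rw [← map_one (algebraMap (𝓞 k) k), ← map_sub]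
    congr 1
    linear_combination (1 - b - a) * hxy
  rw [e] at h2
  refine ⟨algebraMap (𝓞 k) k (a + (1 - b - a) * x), not_isSquare_of_valuation_eq_exp_neg_one h1,
    not_isSquare_of_valuation_eq_exp_neg_one h2,
    not_isSquare_of_valuation_eq_exp_neg_one (v := v.valuation k) ?_⟩
  rw [map_mul, h1, ← neg_sub, Valuation.map_neg]
  have : v.valuation k (1 - algebraMap (𝓞 k) k (a + (1 - b - a) * x)) = 1 := by
    rw [Valuation.map_one_sub_of_lt]
    rw [h1, ← WithZero.exp_zero, WithZero.exp_lt_exp]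
    norm_num
  rw [this, one_mul]

theorem exists_span_singleton_eq_sq {R : Type*} [CommRing R] [IsDedekindDomain R]
    {r : R} (hr : r ≠ 0)
    (h : ∀ v : HeightOneSpectrum R, IsSquare (v.intValuation r)) :
    ∃ J : Ideal R, J ≠ ⊥ ∧ Ideal.span {r} = J ^ 2 := by
  have hI : Ideal.span {r} ≠ ⊥ := by simpa using hr
  have hm : ∀ v : HeightOneSpectrum R, Even (multiplicity v.asIdeal (Ideal.span {r})) := by
    intro v
    obtain ⟨y, hy⟩ := h v
    rw [v.intValuation_eq_exp_neg_multiplicity hr] at hy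
    have hy0 : y ≠ 0 := by
      rintro rfl
      simp at hy
    have := congrArg WithZero.log hy
    rw [WithZero.log_mul hy0 hy0, WithZero.log_exp] at this
    rw [← Int.even_coe_nat]
    exact ⟨-WithZero.log y, by linarith⟩
  have hf := Ideal.finprod_heightOneSpectrum_pow_multiplicity hI
  have e : Ideal.span {r} = (∏ᶠ v : HeightOneSpectrum R,
      v.asIdeal ^ (multiplicity v.asIdeal (Ideal.span {r}) / 2)) ^ 2 := by
    rw [finprod_pow]
    · conv_lhs => rw [← hf]
      refine finprod_congr fun v => ?_
      rw [← pow_mul, Nat.div_mul_cancel (hm v).two_dvd]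
    · refine (Ideal.finite_factors hI).subset fun v hv => ?_
      by_contra hd
      apply hv
      change v.asIdeal ^ _ = 1
      rw [multiplicity_eq_zero.2 hd]
      simp
  refine ⟨_, ?_, e⟩
  intro h0
  rw [h0] at e
  simp at e
  exact hr e

theorem finite_units_quotient_sq (k : Type*) [Field k] [NumberField k] :
    ∃ F : Set (𝓞 k)ˣ, F.Finite ∧ ∀ u, ∃ f ∈ F, ∃ y, u = f * y ^ 2 := by
  let S : Subgroup (𝓞 k)ˣ := (powMonoidHom 2 : (𝓞 k)ˣ →* (𝓞 k)ˣ).range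
  have : Group.FG (𝓞 k)ˣ := Group.fg_iff_monoid_fg.2 inferInstance
  have : Finite ((𝓞 k)ˣ ⧸ S) := by
    refine CommGroup.finite_of_fg_isMulTorsion _ fun s => ?_
    obtain ⟨u, rfl⟩ := QuotientGroup.mk_surjective s
    refine isOfFinOrder_iff_pow_eq_one.2 ⟨2, by norm_num, ?_⟩
    rw [← QuotientGroup.mk_pow, QuotientGroup.eq_one_iff]
    exact ⟨u, rfl⟩
  refine ⟨Set.range (fun s : (𝓞 k)ˣ ⧸ S => s.out), Set.finite_range _, fun u => ?_⟩
  refine ⟨_, ⟨(u : (𝓞 k)ˣ ⧸ S), rfl⟩, ?_⟩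
  have := QuotientGroup.eq.1 (QuotientGroup.out_eq' (u : (𝓞 k)ˣ ⧸ S))
  obtain ⟨y, hy⟩ := this
  exact ⟨y, by rw [show y ^ 2 = _⁻¹ * u from hy, mul_inv_cancel_left]⟩

theorem finite_classes_of_isSquare_valuation (k : Type*) [Field k] [NumberField k] :
    ∃ F : Set kˣ, F.Finite ∧ ∀ c : kˣ,
      (∀ v : HeightOneSpectrum (𝓞 k), IsSquare (v.valuation k c)) →
        ∃ f ∈ F, ∃ y : kˣ, c = f * y ^ 2 := by
  let G := {c : kˣ // ∀ v : HeightOneSpectrum (𝓞 k), IsSquare (v.valuation k c)}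
  have rep : ∀ c : G, ∃ (J : nonZeroDivisors (Ideal (𝓞 k))) (r : 𝓞 k) (y : k), r ≠ 0 ∧ y ≠ 0 ∧
      Ideal.span {r} = J.1 ^ 2 ∧ (c.1 : k) = r * y ^ 2 := by
    rintro ⟨c, hc⟩
    obtain ⟨a, b, hb, e⟩ := IsFractionRing.div_surjective (A := 𝓞 k) (c : k)
    have hb0 : b ≠ 0 := nonZeroDivisors.ne_zero hb
    have hb0' : (algebraMap (𝓞 k) k b) ≠ 0 := by simpa using hb0
    have ha0 : a ≠ 0 := by
      rintro rfl
      rw [map_zero, zero_div] at e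
      exact c.ne_zero e.symm
    have e' : (c : k) * algebraMap (𝓞 k) k b ^ 2 = algebraMap (𝓞 k) k (a * b) := by
      rw [← e, map_mul]
      field_simp
    have hsq : ∀ v : HeightOneSpectrum (𝓞 k), IsSquare (v.intValuation (a * b)) := fun v => by
      rw [← v.valuation_of_algebraMap (K := k)]
      change IsSquare (v.valuation k (algebraMap (𝓞 k) k (a * b)))
      rw [← e', map_mul, map_pow]
      exact (hc v).mul (IsSquare.sq _)
    obtain ⟨J, hJ, e2⟩ := exists_span_singleton_eq_sq (mul_ne_zero ha0 hb0) hsq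
    refine ⟨⟨J, mem_nonZeroDivisors_of_ne_zero hJ⟩, a * b, (algebraMap (𝓞 k) k b)⁻¹,
      mul_ne_zero ha0 hb0, inv_ne_zero hb0', e2, ?_⟩
    change (c : k) = algebraMap (𝓞 k) k (a * b) * _
    rw [← e']
    field_simp
  choose J r y hr hy hJ hc using rep
  obtain ⟨U, hU, hU'⟩ := finite_units_quotient_sq k
  have : Nonempty G := ⟨⟨1, fun v => by simp⟩⟩
  let φ : G → ClassGroup (𝓞 k) := fun c => ClassGroup.mk0 (J c)
  refine ⟨Set.image2 (fun γ u => (Function.invFun φ γ).1 * Units.map (algebraMap (𝓞 k) k) u)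
    Set.univ U, Set.finite_univ.image2 _ hU, fun c hc' => ?_⟩
  have hφ := Function.invFun_eq (f := φ) (b := φ ⟨c, hc'⟩) ⟨_, rfl⟩
  set c₁ := Function.invFun φ (φ ⟨c, hc'⟩)
  obtain ⟨s, t, hs, ht, hst⟩ := ClassGroup.mk0_eq_mk0_iff.1 hφ
  have hspan : Ideal.span {s ^ 2 * r c₁} = Ideal.span {t ^ 2 * r ⟨c, hc'⟩} := by
    simp only [← Ideal.span_singleton_mul_span_singleton, ← Ideal.span_singleton_pow, hJ,
      ← mul_pow, hst]
  obtain ⟨u, hu⟩ := Ideal.span_singleton_eq_span_singleton.1 hspan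
  obtain ⟨f, hf, z, rfl⟩ := hU' u
  have hs' : algebraMap (𝓞 k) k s ≠ 0 := by simpa using hs
  have ht' : algebraMap (𝓞 k) k t ≠ 0 := by simpa using ht
  refine ⟨_, ⟨φ ⟨c, hc'⟩, trivial, f, hf, rfl⟩, Units.map (algebraMap (𝓞 k) k) z *
    Units.mk0 _ hs' * (Units.mk0 _ ht')⁻¹ * (Units.mk0 _ (hy c₁))⁻¹ * Units.mk0 _ (hy ⟨c, hc'⟩), ?_⟩
  ext
  have hu' := congrArg (algebraMap (𝓞 k) k) hu
  simp only [map_mul, map_pow, Units.val_mul, Units.val_pow_eq_pow_val] at hu'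
  have h1 := hc ⟨c, hc'⟩
  have h2 := hc c₁
  simp only [Units.val_mul, Units.val_pow_eq_pow_val, Units.coe_map, Units.val_mk0,
    Units.val_inv_eq_inv_val, MonoidHom.coe_coe]
  change (c : k) = _ at h1
  change (c : k) = (c₁.1 : k) * _ * _
  rw [h1, h2]
  have := hy c₁
  field_simp
  linear_combination -y ⟨c, hc'⟩ ^ 2 * hu'

end NumberField

section RatFuncRamified

/-- The embedding of the units of `k` into the units of `k(x)`. -/
def constUnit {k : Type*} [Field k] : kˣ →* (RatFunc k)ˣ :=
  Units.map (RatFunc.C : k →+* RatFunc k)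

attribute [local instance] Polynomial.algebra

theorem isFractionRing_polynomial_ratFunc (A k : Type*) [CommRing A] [IsDomain A] [Field k]
    [Algebra A k] [IsFractionRing A k] : IsFractionRing (Polynomial A) (RatFunc k) := by
  have hmap : ∀ p : Polynomial A, algebraMap (Polynomial A) (RatFunc k) p =
      algebraMap (Polynomial k) (RatFunc k) (p.map (algebraMap A k)) := fun _ => rfl
  have : FaithfulSMul (Polynomial A) (RatFunc k) := by
    rw [faithfulSMul_iff_algebraMap_injective]
    exact (IsFractionRing.injective (Polynomial k) (RatFunc k)).comp
      (Polynomial.map_injective _ (IsFractionRing.injective A k))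
  refine IsFractionRing.of_field _ _ fun z => ?_
  obtain ⟨p, q, hq, rfl⟩ := IsFractionRing.div_surjective (A := Polynomial k) z
  obtain ⟨b, hb, eb⟩ := IsLocalization.integerNormalization_spec (nonZeroDivisors A) p
  obtain ⟨c, hc, ec⟩ := IsLocalization.integerNormalization_spec (nonZeroDivisors A) q
  have hb0 : algebraMap A k b ≠ 0 := IsFractionRing.to_map_ne_zero_of_mem_nonZeroDivisors hb
  have hc0 : algebraMap A k c ≠ 0 := IsFractionRing.to_map_ne_zero_of_mem_nonZeroDivisors hc
  have hq0 := nonZeroDivisors.ne_zero hq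
  refine ⟨Polynomial.C c * IsLocalization.integerNormalization (nonZeroDivisors A) p,
    Polynomial.C b * IsLocalization.integerNormalization (nonZeroDivisors A) q, ?_⟩
  simp only [hmap, Polynomial.map_mul, Polynomial.map_C, eb, ec, Algebra.smul_def,
    Polynomial.algebraMap_apply, map_mul]
  have h1 : algebraMap (Polynomial k) (RatFunc k) (Polynomial.C (algebraMap A k b)) ≠ 0 := by
    simpa using hb0
  have h2 : algebraMap (Polynomial k) (RatFunc k) (Polynomial.C (algebraMap A k c)) ≠ 0 := by
    simpa using hc0
  have h3 : algebraMap (Polynomial k) (RatFunc k) q ≠ 0 := by simpa using hq0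
  field_simp

section Degree

variable {B : Type*} [CommRing B] [IsDomain B]

theorem mul_sq_ne_sq_of_odd_natDegree {q : Polynomial B} (hq : Odd q.natDegree)
    {r : Polynomial B} (hr : r ≠ 0) (s : Polynomial B) : q * r ^ 2 ≠ s ^ 2 := by
  intro e
  have hq0 : q ≠ 0 := by
    rintro rfl
    simp at hq
  have := congrArg Polynomial.natDegree e
  rw [Polynomial.natDegree_mul hq0 (pow_ne_zero 2 hr), Polynomial.natDegree_pow,
    Polynomial.natDegree_pow] at this
  obtain ⟨n, hn⟩ := hq
  omega

theorem mul_sq_ne_sq_of_odd_natTrailingDegree {q : Polynomial B} (hq : Odd q.natTrailingDegree)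
    {r : Polynomial B} (hr : r ≠ 0) (s : Polynomial B) : q * r ^ 2 ≠ s ^ 2 := by
  intro e
  have hq0 : q ≠ 0 := by
    rintro rfl
    simp at hq
  have hs : s ≠ 0 := by
    rintro rfl
    rw [zero_pow two_ne_zero] at e
    exact mul_ne_zero hq0 (pow_ne_zero 2 hr) e
  have := congrArg Polynomial.natTrailingDegree e
  rw [sq, sq, Polynomial.natTrailingDegree_mul hq0 (mul_ne_zero hr hr),
    Polynomial.natTrailingDegree_mul hr hr, Polynomial.natTrailingDegree_mul hs hs] at this
  obtain ⟨n, hn⟩ := hq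
  omega

end Degree

theorem isRamified_C_of_prime {A k : Type*} [CommRing A] [IsDomain A] [WfDvdMonoid A] [Field k]
    [Algebra A k] [IsFractionRing A k] {π : A} (hπ : Prime π) {u : (RatFunc k)ˣ}
    (hu : (u : RatFunc k) = RatFunc.C (algebraMap A k π)) : IsRamified u := by
  have := isFractionRing_polynomial_ratFunc A k
  have : (Ideal.span {π}).IsPrime := (Ideal.span_singleton_prime hπ.ne_zero).2 hπ
  let φ := Polynomial.mapRingHom (Ideal.Quotient.mk (Ideal.span {π}))
  have hφ : ∀ f : Polynomial A, Polynomial.C π ∣ f ↔ φ f = 0 := fun f => by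
    simp [Polynomial.C_dvd_iff_dvd_coeff, φ, Polynomial.ext_iff, Ideal.Quotient.eq_zero_iff_dvd]
  have hX : φ Polynomial.X = Polynomial.X := Polynomial.map_X _
  have hd : (1 + Polynomial.X : Polynomial (A ⧸ Ideal.span {π})) =
        Polynomial.X + Polynomial.C 1 := by
    rw [Polynomial.C_1, add_comm]
  refine isRamified_of_prime (Polynomial.prime_C_iff.2 hπ) (h := Polynomial.X) (a := 1)
    ?_ ?_ ?_ ?_ (u := u) ?_
  all_goals simp only [hφ, map_sub, map_mul, map_neg, map_pow, map_add, map_one, hX, sub_eq_zero]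
  · refine fun r s hr => mul_sq_ne_sq_of_odd_natDegree ?_ hr _
    simp
  · refine fun r s hr => mul_sq_ne_sq_of_odd_natDegree ?_ hr _
    rw [hd, Polynomial.natDegree_X_add_C]
    exact odd_one
  · refine fun r s hr => mul_sq_ne_sq_of_odd_natTrailingDegree ?_ hr _
    have h1 : (1 + Polynomial.X : Polynomial (A ⧸ Ideal.span {π})).coeff 0 ≠ 0 := by simp
    have h2 : (1 + Polynomial.X : Polynomial (A ⧸ Ideal.span {π})) ≠ 0 := by
      intro h
      simp [h] at h1
    rw [Polynomial.natTrailingDegree_mul Polynomial.X_ne_zero h2,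
      Polynomial.natTrailingDegree_X, Polynomial.natTrailingDegree_eq_zero.2 (Or.inr h1)]
    simp
  · exact one_ne_zero
  · rw [hu, mul_one]
    change _ = algebraMap (Polynomial k) (RatFunc k) ((Polynomial.C π).map _)
    rw [Polynomial.map_C, RatFunc.algebraMap_C]

open IsDedekindDomain NumberField

theorem isRamified_C_of_valuation_eq_exp_neg_one {R k : Type*} [CommRing R] [IsDedekindDomain R]
    [Field k] [Algebra R k] [IsFractionRing R k] (v : HeightOneSpectrum R) {c : k}
    (hc : v.valuation k c = WithZero.exp (-1)) {u : (RatFunc k)ˣ}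
    (hu : (u : RatFunc k) = RatFunc.C c) : IsRamified u := by
  let A := HeightOneSpectrum.valuationSubringAtPrime k v
  have hA : ∀ x : k, x ∈ A ↔ v.valuation k x ≤ 1 := fun x => by
    rw [← Valuation.mem_valuationSubring_iff,
      ← HeightOneSpectrum.valuationSubringAtPrime_eq_valuationSubring]
  have hc0 : c ≠ 0 := by
    rintro rfl
    rw [map_zero] at hc
    exact WithZero.exp_ne_zero hc.symm
  have hlt : WithZero.exp (-1 : ℤ) < 1 := by
    rw [← WithZero.exp_zero, WithZero.exp_lt_exp]
    norm_num
  let π : A := ⟨c, (hA c).2 (hc ▸ hlt.le)⟩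
  have hdvd : ∀ x : A, π ∣ x ↔ v.valuation k x < 1 := by
    intro x
    constructor
    · rintro ⟨y, rfl⟩
      have hy := (hA y).1 y.2
      change v.valuation k (c * y) < 1
      rw [map_mul, hc]
      exact mul_lt_one_of_lt_of_le hlt hy
    · intro hx
      have hx' : v.valuation k x ≤ WithZero.exp (-1) := by
        rcases eq_or_ne (v.valuation k x) 0 with h0 | h0
        · rw [h0]
          exact zero_le
        · rw [← WithZero.exp_log h0, ← WithZero.exp_zero, WithZero.exp_lt_exp] at hx
          rw [← WithZero.exp_log h0, WithZero.exp_le_exp]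
          omega
      refine ⟨⟨x / c, (hA _).2 ?_⟩, Subtype.ext ?_⟩
      · rw [map_div₀, hc]
        exact div_le_one_of_le₀ hx' zero_le
      · change (x : k) = c * (x / c)
        field_simp
  refine isRamified_C_of_prime (A := A) (π := π) ⟨?_, ?_, ?_⟩ hu
  · exact fun h => hc0 (congrArg Subtype.val h)
  · intro h
    have := (hdvd 1).1 h.dvd
    simp at this
  · intro x y h
    simp only [hdvd] at h ⊢
    by_contra! hxy
    refine h.not_ge ?_
    change 1 ≤ v.valuation k (x * y)
    rw [map_mul]
    exact one_le_mul hxy.1 hxy.2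

theorem isRamified_C_of_not_isSquare_valuation {R k : Type*} [CommRing R] [IsDedekindDomain R]
    [Field k] [Algebra R k] [IsFractionRing R k] (v : HeightOneSpectrum R) {c : kˣ}
    (hc : ¬ IsSquare (v.valuation k c)) : IsRamified (constUnit c) := by
  obtain ⟨π, hπ⟩ := v.valuation_exists_uniformizer k
  have hπ0 : π ≠ 0 := by
    rintro rfl
    rw [map_zero] at hπ
    exact WithZero.exp_ne_zero hπ.symm
  have hv0 : v.valuation k c ≠ 0 := by simp
  obtain ⟨n, hn⟩ : ∃ n : ℤ, v.valuation k c = WithZero.exp n := ⟨_, (WithZero.exp_log hv0).symm⟩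
  obtain ⟨m, rfl⟩ : Odd n := by
    rw [← Int.not_even_iff_odd]
    rintro ⟨m, rfl⟩
    exact hc ⟨WithZero.exp m, by rw [hn, WithZero.exp_add]⟩
  let y := Units.mk0 π hπ0 ^ (m + 1)
  refine IsRamified.of_sqCl_eq (sqCl_eq_iff.2 ⟨(constUnit y)⁻¹, ?_⟩)
    (isRamified_C_of_valuation_eq_exp_neg_one v (c := ((c * y ^ 2 : kˣ) : k)) ?_
      (u := constUnit (c * y ^ 2)) rfl)
  · simp
  · simp only [y, Units.val_mul, Units.val_pow_eq_pow_val, Units.val_zpow_eq_zpow_val,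
      Units.val_mk0, map_mul, map_pow, map_zpow₀, hπ, hn, ← WithZero.exp_zsmul,
      ← WithZero.exp_nsmul, ← WithZero.exp_add]
    congr 1
    simp
    ring

end RatFuncRamified

section FiniteUnramified

variable {k : Type*} [Field k]

theorem Irreducible.not_dvd_mul_sq_sub_sq {π : Polynomial k} (hπ : Irreducible π)
    {q : Polynomial k} (hq : ¬ IsSquare (AdjoinRoot.mk π q)) (r s : Polynomial k) (hr : ¬ π ∣ r) :
    ¬ π ∣ q * r ^ 2 - s ^ 2 := by
  have : Fact (Irreducible π) := ⟨hπ⟩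
  intro h
  rw [← AdjoinRoot.mk_eq_zero, map_sub, map_mul, map_pow, map_pow, sub_eq_zero] at h
  rw [← AdjoinRoot.mk_eq_zero] at hr
  refine hq ⟨AdjoinRoot.mk π s / AdjoinRoot.mk π r, ?_⟩
  field_simp
  exact h

theorem Irreducible.numberField_adjoinRoot [NumberField k] {π : Polynomial k}
    (hπ : Irreducible π) : haveI := Fact.mk hπ; NumberField (AdjoinRoot π) := by
  have := Fact.mk hπ
  have : CharZero (AdjoinRoot π) := charZero_of_injective_algebraMap (algebraMap k _).injective
  have : Module.Finite k (AdjoinRoot π) := (AdjoinRoot.powerBasis hπ.ne_zero).finite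
  have : Module.Finite ℚ (AdjoinRoot π) := Module.Finite.trans k _
  exact {}

theorem isRamified_of_irreducible [NumberField k] {π a : Polynomial k} (hπ : Irreducible π)
    (ha : ¬ π ∣ a) {u : (RatFunc k)ˣ}
    (hu : (u : RatFunc k) = algebraMap (Polynomial k) (RatFunc k) (π * a)) : IsRamified u := by
  have := Fact.mk hπ
  have := hπ.numberField_adjoinRoot
  obtain ⟨ϖ, h1, h2, h3⟩ := exists_not_isSquare (AdjoinRoot π)
  obtain ⟨f, rfl⟩ := AdjoinRoot.mk_surjective ϖ
  rw [← map_one (AdjoinRoot.mk π), ← map_sub] at h2 h3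
  rw [← map_mul] at h3
  refine isRamified_of_prime hπ.prime (h := f - 1)
    (hπ.not_dvd_mul_sq_sub_sq ?_) (hπ.not_dvd_mul_sq_sub_sq ?_) (hπ.not_dvd_mul_sq_sub_sq ?_) ha hu
  · rwa [neg_sub]
  · rwa [add_sub_cancel]
  · rwa [add_sub_cancel]

theorem isRamified_or_exists_constUnit_of_polynomial [NumberField k] {u : (RatFunc k)ˣ}
    {f : Polynomial k} (hu : (u : RatFunc k) = algebraMap (Polynomial k) (RatFunc k) f) :
    IsRamified u ∨ ∃ c : kˣ, sqCl u = sqCl (constUnit c) := by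
  induction hn : f.natDegree using Nat.strong_induction_on generalizing f u with
  | _ n ih =>
    subst hn
    have hf0 : f ≠ 0 := by
      rintro rfl
      rw [map_zero] at hu
      exact u.ne_zero hu
    rcases Nat.eq_zero_or_pos f.natDegree with h0 | hpos
    · right
      obtain ⟨c, rfl⟩ := Polynomial.natDegree_eq_zero.1 h0
      have hc : c ≠ 0 := by simpa using hf0
      refine ⟨Units.mk0 c hc, congrArg sqCl (Units.ext ?_)⟩
      rw [hu, RatFunc.algebraMap_C]
      rfl
    obtain ⟨π, hπ, a, rfl⟩ := Polynomial.exists_irreducible_of_natDegree_pos hpos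
    by_cases ha : π ∣ a
    · obtain ⟨b, rfl⟩ := ha
      have hπ0 := hπ.ne_zero
      have hb0 : b ≠ 0 := by
        rintro rfl
        simp at hf0
      have hπ' : algebraMap (Polynomial k) (RatFunc k) π ≠ 0 := by simpa using hπ0
      have hb' : algebraMap (Polynomial k) (RatFunc k) b ≠ 0 := by simpa using hb0
      have hcl : sqCl (Units.mk0 _ hb') = sqCl u :=
        sqCl_eq_iff.2 ⟨Units.mk0 _ hπ', Units.ext (by simp [hu]; ring)⟩
      have hdeg : b.natDegree < (π * (π * b)).natDegree := by
        rw [Polynomial.natDegree_mul hπ0 (mul_ne_zero hπ0 hb0), Polynomial.natDegree_mul hπ0 hb0]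
        have := hπ.natDegree_pos
        omega
      rcases ih _ hdeg (u := Units.mk0 _ hb') rfl rfl with h | ⟨c, h⟩
      · exact Or.inl (h.of_sqCl_eq hcl)
      · exact Or.inr ⟨c, hcl.symm.trans h⟩
    · exact Or.inl (isRamified_of_irreducible hπ ha hu)

theorem isRamified_or_exists_constUnit [NumberField k] (u : (RatFunc k)ˣ) :
    IsRamified u ∨ ∃ c : kˣ, sqCl u = sqCl (constUnit c) := by
  obtain ⟨p, q, hq, e⟩ := IsFractionRing.div_surjective (A := Polynomial k) (u : RatFunc k)
  have hq' : algebraMap (Polynomial k) (RatFunc k) q ≠ 0 :=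
    IsFractionRing.to_map_ne_zero_of_mem_nonZeroDivisors hq
  have hcl : sqCl u = sqCl (u * Units.mk0 _ hq' ^ 2) := sqCl_eq_iff.2 ⟨_, rfl⟩
  have hu : ((u * Units.mk0 _ hq' ^ 2 : (RatFunc k)ˣ) : RatFunc k) =
      algebraMap (Polynomial k) (RatFunc k) (p * q) := by
    simp only [Units.val_mul, Units.val_pow_eq_pow_val, Units.val_mk0, map_mul, ← e]
    field_simp
  rcases isRamified_or_exists_constUnit_of_polynomial hu with h | ⟨c, h⟩
  · exact Or.inl (h.of_sqCl_eq hcl.symm)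
  · exact Or.inr ⟨c, hcl.trans h⟩

variable (k) in
theorem finite_unramifiedClasses [NumberField k] : (unramifiedClasses (RatFunc k)).Finite := by
  obtain ⟨F, hF, h⟩ := finite_classes_of_isSquare_valuation k
  refine (hF.image fun c => sqCl (constUnit c)).subset fun s hs => ?_
  obtain ⟨u, rfl⟩ := sqCl_surjective s
  obtain ⟨c, hc⟩ := (isRamified_or_exists_constUnit u).resolve_left (hs u rfl)
  obtain ⟨f, hf, y, rfl⟩ := h c fun v => by
    by_contra hv
    exact hs _ hc.symm (isRamified_C_of_not_isSquare_valuation v hv)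
  refine ⟨f, hf, ?_⟩
  rw [hc]
  exact sqCl_eq_iff.2 ⟨constUnit y, by simp⟩

end FiniteUnramified

section QuadraticField

open scoped IntermediateField

theorem Nat.not_isSquare_cast_rat_of_squarefree {n : ℕ} (hn : Squarefree n) (h1 : n ≠ 1) :
    ¬ IsSquare (n : ℚ) := by
  rw [Rat.isSquare_natCast_iff]
  rintro ⟨m, rfl⟩
  have := Nat.isUnit_iff.1 (hn m dvd_rfl)
  exact h1 (by rw [this])

theorem exists_eq_add_mul_of_mem_adjoin_sqrt {d : ℚ} {z : ℂ} (hz : z ^ 2 = d) {y : ℂ}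
    (hy : y ∈ ℚ⟮z⟯) : ∃ a b : ℚ, y = a + b * z := by
  have hint : IsIntegral ℚ z := .of_pow two_pos (hz ▸ isIntegral_algebraMap (x := d))
  rw [← IntermediateField.mem_toSubalgebra,
    IntermediateField.adjoin_simple_toSubalgebra_of_isAlgebraic hint.isAlgebraic] at hy
  induction hy using Algebra.adjoin_induction with
  | mem x hx => exact ⟨0, 1, by simpa using hx⟩
  | algebraMap r => exact ⟨r, 0, by simp⟩
  | add x y _ _ hx hy =>
    obtain ⟨a, b, rfl⟩ := hx
    obtain ⟨a', b', rfl⟩ := hy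
    exact ⟨a + a', b + b', by push_cast; ring⟩
  | mul x y _ _ hx hy =>
    obtain ⟨a, b, rfl⟩ := hx
    obtain ⟨a', b', rfl⟩ := hy
    exact ⟨a * a' + b * b' * d, a * b' + a' * b, by push_cast; linear_combination b * b' * hz⟩

theorem sq_ne_of_mem_adjoin_sqrt {n m : ℕ} (hnm : Squarefree (n * m)) (hn : n ≠ 1) (hm : m ≠ 1)
    {z : ℂ} (hz : z ^ 2 = (n * m : ℕ)) {y : ℂ} (hy : y ∈ ℚ⟮z⟯) : y ^ 2 ≠ n := by
  intro e
  have hn0 : (n : ℚ) ≠ 0 := by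
    exact_mod_cast left_ne_zero_of_mul hnm.ne_zero
  obtain ⟨a, b, rfl⟩ :=
    exists_eq_add_mul_of_mem_adjoin_sqrt (d := (n * m : ℕ)) (by exact_mod_cast hz) hy
  have e' : (a : ℂ) ^ 2 + b ^ 2 * (n * m) + 2 * a * b * z = n := by
    push_cast at hz
    linear_combination e - b ^ 2 * hz
  have sq {n : ℕ} (h : Squarefree n) (h1 : n ≠ 1) := Nat.not_isSquare_cast_rat_of_squarefree h h1
  rcases eq_or_ne a 0 with rfl | ha
  · have e2 : (b : ℚ) ^ 2 * (n * m) = n := by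
      have : (b : ℂ) ^ 2 * (n * m) = n := by simpa using e'
      exact_mod_cast this
    have e3 : b ^ 2 * m = 1 := mul_left_cancel₀ hn0 (by linear_combination e2)
    have hb : b ≠ 0 := by
      rintro rfl
      simp at e3
    refine sq (hnm.squarefree_of_dvd (dvd_mul_left m n)) hm ⟨b⁻¹, ?_⟩
    field_simp
    linear_combination e3
  rcases eq_or_ne b 0 with rfl | hb
  · have e2 : (a : ℂ) ^ 2 = n := by simpa using e'
    refine sq (hnm.squarefree_of_dvd (dvd_mul_right n m)) hn ⟨a, ?_⟩
    rw [← pow_two]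
    exact_mod_cast e2.symm
  · have hz' : z = ((n - a ^ 2 - b ^ 2 * (n * m)) / (2 * a * b) : ℚ) := by
      have ha' : (a : ℂ) ≠ 0 := by exact_mod_cast ha
      have hb' : (b : ℂ) ≠ 0 := by exact_mod_cast hb
      push_cast
      field_simp
      linear_combination e'
    refine sq hnm (fun h => hn (Nat.eq_one_of_mul_eq_one_right h))
      ⟨(n - a ^ 2 - b ^ 2 * (n * m)) / (2 * a * b), ?_⟩
    rw [← pow_two]
    rw [hz'] at hz
    exact_mod_cast hz.symm

theorem RatFunc.exists_sq_eq_of_sq_eq_C {k : Type*} [Field k] {w : RatFunc k} {c : k}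
    (h : w ^ 2 = RatFunc.C c) : ∃ y : k, y ^ 2 = c := by
  have hw : IsIntegral (Polynomial k) w := .of_pow two_pos <| by
    rw [h, ← RatFunc.algebraMap_C]
    exact isIntegral_algebraMap
  obtain ⟨f, rfl⟩ := IsIntegrallyClosed.isIntegral_iff.1 hw
  rw [← RatFunc.algebraMap_C, ← map_pow] at h
  have := IsFractionRing.injective (Polynomial k) (RatFunc k) h
  exact ⟨f.eval 0, by rw [← Polynomial.eval_pow, this, Polynomial.eval_C]⟩

theorem numberField_adjoin_sqrt {d : ℚ} {z : ℂ} (hz : z ^ 2 = d) : NumberField ℚ⟮z⟯ where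
  to_finiteDimensional := IntermediateField.adjoin.finiteDimensional <|
    .of_pow two_pos (hz ▸ isIntegral_algebraMap (x := d))

theorem not_isRamified_of_coprime_of_sq_eq_mul {n m : ℕ} (hm : m ≠ 0) (hnm : n.Coprime m) {z : ℂ}
    (hz : z ^ 2 = (n * m : ℕ)) {u : (RatFunc ℚ⟮z⟯)ˣ} (hu : (u : RatFunc ℚ⟮z⟯) = n) :
    ¬ IsRamified u := by
  have : CharZero (RatFunc ℚ⟮z⟯) := charZero_of_injective_algebraMap
    (algebraMap ℚ⟮z⟯ (RatFunc ℚ⟮z⟯)).injective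
  rintro ⟨T, H, hp, hH⟩
  refine hH (hp.mem_of_coprime_of_mul_eq_sq hu (Nat.cast_ne_zero.2 hm) hnm
    (e := RatFunc.C (IntermediateField.AdjoinSimple.gen ℚ z)) ?_)
  have e : IntermediateField.AdjoinSimple.gen ℚ z ^ 2 = (n * m : ℕ) := by
    ext
    simpa using hz
  rw [← map_pow, e, map_natCast, Nat.cast_mul]

theorem sqCl_ne_sqCl_of_sq_eq_mul {p q m : ℕ} (hd : Squarefree (p * q * m)) (hpq : p * q ≠ 1)
    (hm : m ≠ 1) {z : ℂ} (hz : z ^ 2 = (p * q * m : ℕ)) {u v : (RatFunc ℚ⟮z⟯)ˣ}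
    (hu : (u : RatFunc ℚ⟮z⟯) = p) (hv : (v : RatFunc ℚ⟮z⟯) = q) : sqCl u ≠ sqCl v := by
  intro h
  obtain ⟨w, rfl⟩ := sqCl_eq_iff.1 h
  rw [Units.val_mul, Units.val_pow_eq_pow_val, hu] at hv
  obtain ⟨y, hy⟩ := RatFunc.exists_sq_eq_of_sq_eq_C (w := (p : RatFunc ℚ⟮z⟯) * (w : RatFunc ℚ⟮z⟯))
    (c := ((p * q : ℕ) : ℚ⟮z⟯)) <| by
      rw [map_natCast, Nat.cast_mul, ← hv]
      ring
  refine sq_ne_of_mem_adjoin_sqrt hd hpq hm hz y.2 ?_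
  simpa using congrArg Subtype.val hy

theorem squarefree_prod_of_prime {S : Finset ℕ} (hS : ∀ p ∈ S, p.Prime) :
    Squarefree (∏ p ∈ S, p) :=
  Finset.squarefree_prod_of_pairwise_isCoprime
    (fun _ hp _ hq hpq => Nat.coprime_iff_isRelPrime.1
      ((Nat.coprime_primes (hS _ hp) (hS _ hq)).2 hpq))
    fun p hp => (hS p hp).squarefree

theorem card_le_ncard_unramifiedClasses {S : Finset ℕ} (hS : ∀ p ∈ S, p.Prime) (hcard : 3 ≤ S.card)
    {z : ℂ} (hz : z ^ 2 = (∏ p ∈ S, p : ℕ)) :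
    S.card ≤ (unramifiedClasses (RatFunc ℚ⟮z⟯)).ncard := by
  have : NumberField ℚ⟮z⟯ := numberField_adjoin_sqrt (d := (∏ p ∈ S, p : ℕ)) (by exact_mod_cast hz)
  have : CharZero (RatFunc ℚ⟮z⟯) := charZero_of_injective_algebraMap
    (algebraMap ℚ⟮z⟯ (RatFunc ℚ⟮z⟯)).injective
  have hsf := squarefree_prod_of_prime hS
  have hex : ∀ p ∈ S, ∃ u : (RatFunc ℚ⟮z⟯)ˣ, (u : RatFunc ℚ⟮z⟯) = p := fun p hp =>
    ⟨Units.mk0 _ (Nat.cast_ne_zero.2 (hS p hp).ne_zero), rfl⟩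
  choose! u hu using hex
  rw [← Set.ncard_coe_finset]
  refine Set.ncard_le_ncard_of_injOn (fun p => sqCl (u p)) ?_ ?_ (finite_unramifiedClasses _)
  · intro p hp a ha hr
    have e := Finset.mul_prod_erase S (fun p => p) hp
    rw [← e] at hz hsf
    exact not_isRamified_of_coprime_of_sq_eq_mul (right_ne_zero_of_mul hsf.ne_zero)
      (Nat.coprime_of_squarefree_mul hsf) hz (hu p hp) (hr.of_sqCl_eq ha)
  · intro p hp q hq h
    by_contra hpq
    have hq' : q ∈ S.erase p := Finset.mem_erase.2 ⟨Ne.symm hpq, hq⟩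
    have e : p * q * ∏ r ∈ (S.erase p).erase q, r = ∏ r ∈ S, r := by
      rw [mul_assoc, Finset.mul_prod_erase (S.erase p) (fun p => p) hq',
        Finset.mul_prod_erase S (fun p => p) hp]
    rw [← e] at hz hsf
    refine sqCl_ne_sqCl_of_sq_eq_mul hsf ?_ ?_ hz (hu p hp) (hu q hq) h
    · exact fun h1 => (hS p hp).ne_one (Nat.eq_one_of_mul_eq_one_right h1)
    · obtain ⟨r, hr⟩ : ((S.erase p).erase q).Nonempty := by
        rw [← Finset.card_pos, Finset.card_erase_of_mem hq', Finset.card_erase_of_mem hp]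
        omega
      intro h1
      have := Finset.dvd_prod_of_mem (fun p => p) hr
      rw [h1] at this
      exact (hS r (Finset.mem_of_mem_erase (Finset.mem_of_mem_erase hr))).ne_one
        (Nat.dvd_one.1 this)

theorem ncard_unramifiedClasses_eq_of_sq_eq_sq {z w : ℂ} (h : z ^ 2 = w ^ 2) :
    (unramifiedClasses (RatFunc ℚ⟮z⟯)).ncard = (unramifiedClasses (RatFunc ℚ⟮w⟯)).ncard := by
  have e : ℚ⟮z⟯ = ℚ⟮w⟯ := by
    rcases sq_eq_sq_iff_eq_or_eq_neg.1 h with rfl | rfl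
    · rfl
    · refine le_antisymm ?_ ?_ <;> rw [IntermediateField.adjoin_simple_le_iff]
      · exact neg_mem (IntermediateField.mem_adjoin_simple_self ℚ w)
      · exact neg_mem_iff.1 (IntermediateField.mem_adjoin_simple_self ℚ (-w))
  rw [e]

theorem exists_lt_ncard_unramifiedClasses (N : ℕ) : ∃ d : ℤ, (Squarefree d ∧ d ≠ 0 ∧ d ≠ 1) ∧
    ∀ z : ℂ, z ^ 2 = d → N < (unramifiedClasses (RatFunc ℚ⟮z⟯)).ncard := by
  obtain ⟨S, hS, hcard⟩ := Nat.infinite_setOfPred_prime.exists_subset_card_eq (N + 3)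
  have hsf := squarefree_prod_of_prime hS
  refine ⟨(∏ p ∈ S, p : ℕ), ⟨Int.squarefree_natCast.2 hsf, by exact_mod_cast hsf.ne_zero, ?_⟩,
    fun z hz => ?_⟩
  · intro h1
    obtain ⟨p, hp⟩ : S.Nonempty := Finset.card_pos.1 (by omega)
    have := Finset.dvd_prod_of_mem (fun p => p) hp
    rw [show ∏ p ∈ S, p = 1 by exact_mod_cast h1] at this
    exact (hS hp).ne_one (Nat.dvd_one.1 this)
  · have := card_le_ncard_unramifiedClasses hS (by omega) (z := z) (by exact_mod_cast hz)
    omega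

end QuadraticField

/-- There are infinitely many pairwise Witt-inequivalent fields of the form `k(x)` with
`k` a quadratic extension of `ℚ`: for every `n` there are pairwise distinct squarefree
integers `d₁, …, dₙ ∉ {0,1}` such that the rational function fields `ℚ(√dᵢ)(x)` are
pairwise not Witt equivalent.  Here `ℚ(√d)` is realised inside `ℂ` as `ℚ⟮z⟯` for a
complex square root `z` of `d`. -/
theorem infinitely_many_wittInequivalent_quadratic_ratFunc (n : ℕ) :
    ∃ d : Fin n → ℤ,
      Function.Injective d ∧
      (∀ i, Squarefree (d i) ∧ d i ≠ 0 ∧ d i ≠ 1) ∧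
      ∀ (i j : Fin n) (z w : ℂ), z ^ 2 = (d i : ℂ) → w ^ 2 = (d j : ℂ) → i ≠ j →
        ¬ WittEquivalent (RatFunc (IntermediateField.adjoin ℚ ({z} : Set ℂ)))
            (RatFunc (IntermediateField.adjoin ℚ ({w} : Set ℂ))) := by
  choose sqrt hsqrt using fun d : ℤ => IsAlgClosed.exists_pow_nat_eq (d : ℂ) two_pos
  let g : ℤ → ℕ := fun d => (unramifiedClasses (RatFunc (IntermediateField.adjoin ℚ {sqrt d}))).ncard
  have hinf : (g '' {d | Squarefree d ∧ d ≠ 0 ∧ d ≠ 1}).Infinite :=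
    Set.infinite_of_forall_exists_gt fun N => by
      obtain ⟨d, hd, h⟩ := exists_lt_ncard_unramifiedClasses N
      exact ⟨g d, ⟨d, hd, rfl⟩, h _ (hsqrt d)⟩
  choose d hd hg using fun i : Fin n => (hinf.natEmbedding _ i).2
  have hinj : Function.Injective (g ∘ d) := fun i j hij => by
    simp only [Function.comp_apply, hg] at hij
    exact Fin.ext ((hinf.natEmbedding _).injective (Subtype.ext hij))
  refine ⟨d, hinj.of_comp, hd, fun i j z w hz hw hij h => hij (hinj ?_)⟩
  have h1 := ncard_unramifiedClasses_eq_of_sq_eq_sq (hz.trans (hsqrt (d i)).symm)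
  have h2 := ncard_unramifiedClasses_eq_of_sq_eq_sq (hw.trans (hsqrt (d j)).symm)
  exact h1.symm.trans (h.ncard_unramifiedClasses_eq.trans h2)

end
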